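/- arXiv:2501.16941 — 3 statements merged into one kernel-verified Lean document; each statement's English description precedes it below -/
import Mathlib

section
/- Let J and N be finite nilpotent groups with J acting on N by automorphisms. The natural projections N → N_p onto the Sylow p-subgroups of N (which are J-invariant since they are characteristic) induce a bijection H¹(J, N) ≅ ∏_{p ∈ D} H¹(J, N_p), where D is the set of primes dividing both |J| and |N|. -/
section

variable {N J : Type*} [Group N] [Group J] (φ : J →* MulAut N)

/-- Crossed homomorphisms `J → N`. -/
def CrossedHom : Type _ := {f : J → N // ∀ j j', f (j * j') = f j * φ j (f j')}

/-- The cohomology relation on crossed homomorphisms. -/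
def cohRel (f g : CrossedHom φ) : Prop :=
  ∃ n : N, ∀ j, g.1 j = n⁻¹ * f.1 j * φ j n

/-- Crossed homomorphisms `J → N` taking values in a subgroup `M ≤ N`. -/
def CrossedHomIn (M : Subgroup N) : Type _ :=
  {f : J → N // (∀ j j', f (j * j') = f j * φ j (f j')) ∧ ∀ j, f j ∈ M}

/-- The cohomology relation for crossed homomorphisms valued in `M`
(the conjugating element is taken in `M`). -/
def cohRelIn (M : Subgroup N) (f g : CrossedHomIn φ M) : Prop :=
  ∃ n ∈ M, ∀ j, g.1 j = n⁻¹ * f.1 j * φ j n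

end

section PrimaryPart

/-- An exponent congruent to `1` modulo the `p`-part of `n` and to `0` modulo its prime-to-`p`
part. -/
def primaryExponent (n p : ℕ) : ℕ := (ordCompl[p] n) ^ Nat.totient (ordProj[p] n)

theorem primaryExponent_modEq_one {n p : ℕ} (hp : p.Prime) (hn : n ≠ 0) :
    primaryExponent n p ≡ 1 [MOD ordProj[p] n] :=
  Nat.ModEq.pow_totient ((Nat.coprime_ordCompl hp hn).symm.pow_right _)

theorem ordCompl_dvd_primaryExponent {n p : ℕ} (hp : p.Prime) :
    ordCompl[p] n ∣ primaryExponent n p :=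
  dvd_pow_self _ (Nat.totient_pos.2 (pow_pos hp.pos _)).ne'

variable {N : Type*} [Group N]

theorem pow_primaryExponent_of_coprime {p : ℕ} [Fact p.Prime] {x : N}
    (h : (orderOf x).Coprime p) : x ^ primaryExponent (Nat.card N) p = 1 := by
  refine orderOf_dvd_iff_pow_eq_one.1 (dvd_trans ?_ (ordCompl_dvd_primaryExponent Fact.out))
  have h1 : orderOf x ∣ ordProj[p] (Nat.card N) * ordCompl[p] (Nat.card N) := by
    rw [Nat.ordProj_mul_ordCompl_eq_self]
    exact orderOf_dvd_natCard x
  exact (h.pow_right _).dvd_of_dvd_mul_left h1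

variable [Finite N]

theorem pow_primaryExponent_of_mem_sylow {p : ℕ} [Fact p.Prime] (P : Sylow p N) {x : N}
    (hx : x ∈ P) : x ^ primaryExponent (Nat.card N) p = x := by
  have h : orderOf x ∣ ordProj[p] (Nat.card N) := by
    rw [← P.card_eq_multiplicity]
    exact Subgroup.orderOf_dvd_natCard _ hx
  conv_rhs => rw [← pow_one x]
  exact pow_eq_pow_iff_modEq.2
    ((primaryExponent_modEq_one Fact.out Nat.card_pos.ne').of_dvd h)

theorem coprime_orderOf_of_mem_sylow {p q : ℕ} [hp : Fact p.Prime] [hq : Fact q.Prime]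
    (hpq : p ≠ q) (P : Sylow q N) {x : N} (hx : x ∈ P) : (orderOf x).Coprime p := by
  have h : orderOf x ∣ q ^ (Nat.card N).factorization q := by
    rw [← P.card_eq_multiplicity]
    exact Subgroup.orderOf_dvd_natCard _ hx
  exact (((Nat.coprime_primes hq.out hp.out).2 hpq.symm).pow_left _).coprime_dvd_left h

variable [Group.IsNilpotent N]

theorem mul_pow_primaryExponent {p : ℕ} [hp : Fact p.Prime] (x y : N) :
    (x * y) ^ primaryExponent (Nat.card N) p =
      x ^ primaryExponent (Nat.card N) p * y ^ primaryExponent (Nat.card N) p := by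
  let ψ := Sylow.directProductOfNormal (G := N) fun _ => inferInstance
  obtain ⟨a, rfl⟩ := ψ.surjective x
  obtain ⟨b, rfl⟩ := ψ.surjective y
  simp only [← map_mul, ← map_pow]
  congr 1
  funext q Q
  have hq : Fact (q : ℕ).Prime := ⟨Nat.prime_of_mem_primeFactors q.2⟩
  simp only [Pi.pow_apply, Pi.mul_apply]
  by_cases h : p = q
  · obtain ⟨q, hqm⟩ := q
    obtain rfl : p = q := h
    have H (z : Q) : z ^ primaryExponent (Nat.card N) p = z :=
      Subtype.ext (pow_primaryExponent_of_mem_sylow Q z.2)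
    rw [H, H, H]
  · have H (z : Q) : z ^ primaryExponent (Nat.card N) p = 1 :=
      Subtype.ext (pow_primaryExponent_of_coprime (coprime_orderOf_of_mem_sylow h Q z.2))
    rw [H, H, H, one_mul]

variable (N) in
/-- The projection of a finite nilpotent group onto its Sylow `p`-subgroup. -/
noncomputable def primaryPart (p : ℕ) [Fact p.Prime] : N →* N where
  toFun x := x ^ primaryExponent (Nat.card N) p
  map_one' := one_pow _
  map_mul' := mul_pow_primaryExponent

variable {p : ℕ} [hp : Fact p.Prime]

theorem primaryPart_of_coprime {x : N} (h : (orderOf x).Coprime p) : primaryPart N p x = 1 :=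
  pow_primaryExponent_of_coprime h

theorem primaryPart_of_mem (P : Sylow p N) {x : N} (hx : x ∈ P) : primaryPart N p x = x :=
  pow_primaryExponent_of_mem_sylow P hx

theorem map_primaryPart {F : Type*} [FunLike F N N] [MonoidHomClass F N N] (f : F) (x : N) :
    f (primaryPart N p x) = primaryPart N p (f x) :=
  map_pow f x _

theorem primaryPart_mem (P : Sylow p N) (x : N) : primaryPart N p x ∈ P := by
  have h : IsPGroup p (Subgroup.zpowers (primaryPart N p x)) := by
    have hdvd : orderOf (primaryPart N p x) ∣ ordProj[p] (Nat.card N) := by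
      refine orderOf_dvd_of_pow_eq_one ?_
      change (x ^ primaryExponent (Nat.card N) p) ^ ordProj[p] (Nat.card N) = 1
      rw [← pow_mul, ← orderOf_dvd_iff_pow_eq_one]
      refine (orderOf_dvd_natCard x).trans ?_
      conv_lhs => rw [← Nat.ordProj_mul_ordCompl_eq_self (Nat.card N) p, mul_comm]
      exact Nat.mul_dvd_mul_right (ordCompl_dvd_primaryExponent hp.out) _
    obtain ⟨k, -, hk⟩ := (Nat.dvd_prime_pow hp.out).1 hdvd
    exact IsPGroup.of_card ((Nat.card_zpowers _).trans hk)
  obtain ⟨Q, hQ⟩ := h.exists_le_sylow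
  have := P.unique_of_normal inferInstance
  rw [Subsingleton.elim P Q]
  exact hQ (Subgroup.mem_zpowers _)

theorem primaryPart_primaryPart_of_ne {q : ℕ} [Fact q.Prime] (h : p ≠ q) (x : N) :
    primaryPart N p (primaryPart N q x) = 1 :=
  primaryPart_of_coprime
    (coprime_orderOf_of_mem_sylow h (default : Sylow q N) (primaryPart_mem _ x))

theorem eq_one_of_primaryPart_eq_one {x : N}
    (h : ∀ (q : ℕ) [Fact q.Prime], q ∣ Nat.card N → primaryPart N q x = 1) : x = 1 := by
  rw [← orderOf_eq_one_iff]
  refine Nat.eq_one_iff_not_exists_prime_dvd.2 fun q hq hqx => ?_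
  have := Fact.mk hq
  have hqN := hqx.trans (orderOf_dvd_natCard x)
  have h1 : q ∣ primaryExponent (Nat.card N) q :=
    hqx.trans (orderOf_dvd_of_pow_eq_one (h q hqN))
  have h2 := (primaryExponent_modEq_one hq Nat.card_pos.ne').of_dvd
    ((dvd_pow_self q (hq.factorization_pos_of_dvd Nat.card_pos.ne' hqN).ne'))
  exact hq.one_lt.ne' (Nat.dvd_one.1 ((h2.dvd_iff dvd_rfl).1 h1))

theorem eq_of_primaryPart_eq {x y : N}
    (h : ∀ (q : ℕ) [Fact q.Prime], q ∣ Nat.card N → primaryPart N q x = primaryPart N q y) :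
    x = y :=
  inv_mul_eq_one.1 <| eq_one_of_primaryPart_eq_one fun q _ hq => by
    rw [map_mul, map_inv, h q hq, inv_mul_cancel]

theorem exists_primaryPart_eq (n : ℕ → N)
    (hn : ∀ (q : ℕ) [Fact q.Prime], q ∣ Nat.card N → primaryPart N q (n q) = n q) :
    ∃ x, ∀ (q : ℕ) [Fact q.Prime], q ∣ Nat.card N → primaryPart N q x = n q := by
  suffices H : ∀ s ⊆ (Nat.card N).primeFactors, ∃ x, ∀ (q : ℕ) [Fact q.Prime],
      primaryPart N q x = if q ∈ s then n q else 1 by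
    obtain ⟨x, hx⟩ := H _ subset_rfl
    refine ⟨x, fun q hq hqN => ?_⟩
    rw [hx, if_pos (Nat.mem_primeFactors.2 ⟨hq.out, hqN, Nat.card_pos.ne'⟩)]
  intro s
  induction s using Finset.induction_on with
  | empty => exact fun _ => ⟨1, fun q _ => by simp⟩
  | insert r s hr ih =>
    intro hs
    obtain ⟨x, hx⟩ := ih ((Finset.subset_insert r s).trans hs)
    have hrN := hs (Finset.mem_insert_self r s)
    have := Fact.mk (Nat.prime_of_mem_primeFactors hrN)
    have hnr := hn r (Nat.dvd_of_mem_primeFactors hrN)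
    refine ⟨n r * x, fun q _ => ?_⟩
    rw [map_mul, hx]
    by_cases hqr : q = r
    · subst hqr
      simp [hr, hnr]
    · rw [← hnr, primaryPart_primaryPart_of_ne hqr]
      simp [hqr]

end PrimaryPart

section Coprime

theorem exists_mul_eq_self_of_coprime {A J : Type*} [CommGroup A] [Group J] [Finite J]
    (hco : (Nat.card A).Coprime (Nat.card J)) (α : J → A →* A) (z : J → A)
    (hz : ∀ j k, z (j * k) = z j * α j (z k)) : ∃ b, ∀ j, z j * α j b = b := by
  have := Fintype.ofFinite J
  let a := ∏ k, z k
  have ha (j : J) : z j ^ Nat.card J * α j a = a := by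
    calc z j ^ Nat.card J * α j a = ∏ k, z (j * k) := by
          simp [hz, Finset.prod_mul_distrib, a]
      _ = a := Equiv.prod_comp (Equiv.mulLeft j) z
  let b := (powCoprime hco).symm a
  have hb : b ^ Nat.card J = a := (powCoprime hco).apply_symm_apply a
  refine ⟨b, fun j => (powCoprime hco).injective ?_⟩
  simp only [powCoprime_apply, mul_pow, ← map_pow, hb, ha]

/-- A crossed homomorphism of finite groups of coprime orders, with nilpotent target, is
cohomologous to the trivial one. -/
theorem CrossedHom.exists_trivialization_of_coprime {J : Type*} [Group J] [Finite J]
    (N : Type*) [Group N] [Group.IsNilpotent N] :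
    ∀ [Finite N] (_ : (Nat.card N).Coprime (Nat.card J)) (φ : J →* MulAut N) (f : CrossedHom φ),
      ∃ n : N, ∀ j, n⁻¹ * f.1 j * φ j n = 1 := by
  refine Group.nilpotent_center_quotient_ind
    (P := fun N _ _ => ∀ [Finite N] (_ : (Nat.card N).Coprime (Nat.card J)) (φ : J →* MulAut N)
      (f : CrossedHom φ), ∃ n : N, ∀ j, n⁻¹ * f.1 j * φ j n = 1) N ?_ ?_
  · exact fun _ _ _ _ _ _ _ => ⟨1, fun _ => Subsingleton.elim _ _⟩
  · intro N _ _ ih _ hco φ f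
    have hmap (j : J) : (Subgroup.center N).map (φ j : N →* N) = Subgroup.center N :=
      Subgroup.characteristic_iff_map_eq.1 inferInstance (φ j)
    let φ' : J →* MulAut (N ⧸ Subgroup.center N) := MonoidHom.mk'
      (fun j => QuotientGroup.congr _ _ (φ j) (hmap j)) fun a b => by
        ext x
        induction x using QuotientGroup.induction_on
        simp
    obtain ⟨n, hn⟩ := ih (hco.coprime_dvd_left (Subgroup.card_quotient_dvd_card _)) φ'
      ⟨fun j => f.1 j, fun j k => congrArg _ (f.2 j k)⟩
    induction n using QuotientGroup.induction_on with | H n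
    have hz (j : J) : n⁻¹ * f.1 j * φ j n ∈ Subgroup.center N :=
      (QuotientGroup.eq_one_iff _).1 (hn j)
    let z (j : J) : Subgroup.center N := ⟨_, hz j⟩
    have hφ (j : J) (x : Subgroup.center N) : φ j x ∈ Subgroup.center N :=
      (hmap j).le (Subgroup.mem_map_of_mem _ x.2)
    let α (j : J) : Subgroup.center N →* Subgroup.center N :=
      ((φ j : N →* N).comp (Subgroup.subtype _)).codRestrict _ (hφ j)
    have hα (j : J) (x : Subgroup.center N) : (α j x : N) = φ j x := rfl
    let _ : CommGroup (Subgroup.center N) :=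
      { (inferInstance : Group (Subgroup.center N)) with
        mul_comm := fun x y => Subtype.ext (Subgroup.mem_center_iff.1 y.2 x) }
    obtain ⟨b, hb⟩ := exists_mul_eq_self_of_coprime
      (hco.coprime_dvd_left (Subgroup.card_subgroup_dvd_card _)) α z fun j k => by
        apply Subtype.ext
        simp [z, hα, f.2 j k, mul_assoc]
    refine ⟨n * b, fun j => ?_⟩
    have hbj : n⁻¹ * f.1 j * φ j n * φ j b = b := congrArg Subtype.val (hb j)
    rw [map_mul, mul_inv_rev, mul_assoc (b : N)⁻¹, mul_assoc (b : N)⁻¹, ← mul_assoc _ (φ j n), hbj,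
      inv_mul_cancel]

theorem CrossedHomIn.exists_trivialization_of_coprime {J N : Type*} [Group J] [Finite J]
    [Group N] (φ : J →* MulAut N) (M : Subgroup N) [Finite M] [Group.IsNilpotent M]
    (hM : ∀ j, ∀ n ∈ M, φ j n ∈ M) (hco : (Nat.card M).Coprime (Nat.card J))
    (f : CrossedHomIn φ M) : ∃ n ∈ M, ∀ j, n⁻¹ * f.1 j * φ j n = 1 := by
  let φ' : J →* MulAut M := MonoidHom.mk' (fun j =>
    { toFun x := ⟨φ j x, hM j x x.2⟩
      invFun x := ⟨φ j⁻¹ x, hM j⁻¹ x x.2⟩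
      left_inv x := by simp
      right_inv x := by simp
      map_mul' x y := by simp }) fun a b => by ext; simp
  obtain ⟨n, hn⟩ := CrossedHom.exists_trivialization_of_coprime M hco φ'
    ⟨fun j => ⟨f.1 j, f.2.2 j⟩, fun j k => Subtype.ext (f.2.1 j k)⟩
  exact ⟨n, n.2, fun j => congrArg Subtype.val (hn j)⟩

end Coprime

section Cohomologous

variable {N J : Type*} [Group N] [Group J] (φ : J →* MulAut N)

theorem cohRelIn_equivalence (M : Subgroup N) : Equivalence (cohRelIn φ M) where
  refl f := ⟨1, M.one_mem, by simp⟩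
  symm := by
    rintro f g ⟨n, hn, h⟩
    exact ⟨n⁻¹, M.inv_mem hn, fun j => by simp [h, mul_assoc]⟩
  trans := by
    rintro f g k ⟨n, hn, h⟩ ⟨m, hm, h'⟩
    exact ⟨n * m, M.mul_mem hn hm, fun j => by simp [h, h', mul_assoc]⟩

variable [Finite N] [Group.IsNilpotent N] {φ}

/-- The `p`-component of a crossed homomorphism into a finite nilpotent group. -/
noncomputable def CrossedHom.primaryPart {p : ℕ} [Fact p.Prime] (P : Sylow p N) (f : CrossedHom φ) :
    CrossedHomIn φ (P : Subgroup N) :=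
  ⟨fun j => _root_.primaryPart N p (f.1 j),
    fun j k => by simp only [f.2 j k, map_mul, map_primaryPart], fun j => primaryPart_mem P _⟩

theorem CrossedHom.cohRelIn_primaryPart {p : ℕ} [Fact p.Prime] (P : Sylow p N)
    {f g : CrossedHom φ} (h : cohRel φ f g) :
    cohRelIn φ (P : Subgroup N) (f.primaryPart P) (g.primaryPart P) := by
  obtain ⟨n, hn⟩ := h
  refine ⟨_root_.primaryPart N p n, primaryPart_mem P n, fun j => ?_⟩
  simp [CrossedHom.primaryPart, hn, map_primaryPart]

theorem CrossedHom.cohRelIn_primaryPart_of_not_dvd [Finite J] {p : ℕ} [hp : Fact p.Prime]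
    (hpJ : ¬ p ∣ Nat.card J) (P : Sylow p N) (f g : CrossedHom φ) :
    cohRelIn φ (P : Subgroup N) (f.primaryPart P) (g.primaryPart P) := by
  have hP (j : J) (n : N) (hn : n ∈ (P : Subgroup N)) : φ j n ∈ (P : Subgroup N) := by
    rw [← primaryPart_of_mem P hn, map_primaryPart]
    exact primaryPart_mem P _
  have hco : (Nat.card (P : Subgroup N)).Coprime (Nat.card J) := by
    obtain ⟨k, hk⟩ := IsPGroup.iff_card.1 P.isPGroup'
    rw [hk]
    exact ((Nat.Prime.coprime_iff_not_dvd hp.out).2 hpJ).pow_left k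
  let one : CrossedHomIn φ (P : Subgroup N) := ⟨fun _ => 1, by simp, fun _ => P.one_mem⟩
  have H (f : CrossedHomIn φ (P : Subgroup N)) : cohRelIn φ P f one := by
    obtain ⟨n, hn, h⟩ := CrossedHomIn.exists_trivialization_of_coprime φ P hP hco f
    exact ⟨n, hn, fun j => (h j).symm⟩
  exact (cohRelIn_equivalence φ _).trans (H _) ((cohRelIn_equivalence φ _).symm (H _))

theorem CrossedHom.cohRel_of_primaryPart {f g : CrossedHom φ}
    (h : ∀ (p : ℕ) [Fact p.Prime], p ∣ Nat.card N → ∃ P : Sylow p N,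
      cohRelIn φ (P : Subgroup N) (f.primaryPart P) (g.primaryPart P)) : cohRel φ f g := by
  have h' (p : ℕ) : ∃ n : N, ∀ [Fact p.Prime], p ∣ Nat.card N → _root_.primaryPart N p n = n ∧
      ∀ j, _root_.primaryPart N p (g.1 j) = n⁻¹ * _root_.primaryPart N p (f.1 j) * φ j n := by
    by_cases hp : p.Prime ∧ p ∣ Nat.card N
    · have := Fact.mk hp.1
      obtain ⟨P, n, hn, hfg⟩ := h p hp.2
      exact ⟨n, fun _ => ⟨primaryPart_of_mem P hn, hfg⟩⟩
    · exact ⟨1, fun {hp'} hpN => (hp ⟨hp'.out, hpN⟩).elim⟩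
  choose n hn using h'
  obtain ⟨x, hx⟩ := exists_primaryPart_eq n fun q _ hq => (hn q hq).1
  refine ⟨x, fun j => eq_of_primaryPart_eq fun q _ hq => ?_⟩
  rw [map_mul, map_mul, map_inv, ← map_primaryPart, hx q hq, (hn q hq).2]

theorem CrossedHom.exists_primaryPart_eq (g : ℕ → J → N)
    (hg : ∀ (p : ℕ) [Fact p.Prime], p ∣ Nat.card N → (∀ j k, g p (j * k) = g p j * φ j (g p k)) ∧
      ∀ j, _root_.primaryPart N p (g p j) = g p j) :
    ∃ f : CrossedHom φ, ∀ (p : ℕ) [Fact p.Prime], p ∣ Nat.card N → ∀ j,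
      _root_.primaryPart N p (f.1 j) = g p j := by
  choose f hf using fun j => _root_.exists_primaryPart_eq (fun p => g p j)
    fun p _ hp => (hg p hp).2 j
  refine ⟨⟨f, fun j k => eq_of_primaryPart_eq fun p _ hp => ?_⟩, fun p _ hp j => hf j p hp⟩
  rw [map_mul, ← map_primaryPart, hf _ p hp, hf _ p hp, hf _ p hp, (hg p hp).1]

end Cohomologous

/-- (Primary decomposition over `N`.) For finite nilpotent `J`, `N`, the projections
of `N` onto its Sylow subgroups `N_p` induce a bijection
`H¹(J, N) ≅ ∏_{p ∈ D} H¹(J, N_p)`, `D` the primes dividing both `|J|` and `|N|`.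
The compatibility condition says: if each `g p` is the pointwise `N_p`-component of
`f` (i.e. `g p j ∈ N_p` and `f j * (g p j)⁻¹` has order coprime to `p`), then the
bijection sends the class of `f` to the classes of the `g p`. -/
theorem stmt_7 {N J : Type*} [Group N] [Group J] [Finite N] [Finite J]
    [Group.IsNilpotent N] [Group.IsNilpotent J]
    (φ : J →* MulAut N)
    (Np : ∀ p : {p : ℕ // p.Prime ∧ p ∣ Nat.card J ∧ p ∣ Nat.card N}, Sylow p.1 N)
    (hNp : ∀ p j n, n ∈ (Np p : Subgroup N) → φ j n ∈ (Np p : Subgroup N)) :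
    ∃ e : Quot (cohRel φ) ≃
        (∀ p : {p : ℕ // p.Prime ∧ p ∣ Nat.card J ∧ p ∣ Nat.card N},
          Quot (cohRelIn φ (Np p : Subgroup N))),
      ∀ (f : CrossedHom φ)
        (g : ∀ p : {p : ℕ // p.Prime ∧ p ∣ Nat.card J ∧ p ∣ Nat.card N},
          CrossedHomIn φ (Np p : Subgroup N)),
        (∀ p j, Nat.Coprime (orderOf (f.1 j * ((g p).1 j)⁻¹)) p.1) →
        e (Quot.mk _ f) = fun p => Quot.mk _ (g p) := by
  classical
  have hF (p : {p : ℕ // p.Prime ∧ p ∣ Nat.card J ∧ p ∣ Nat.card N}) : Fact p.1.Prime := ⟨p.2.1⟩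
  let e : Quot (cohRel φ) → ∀ p : {p : ℕ // p.Prime ∧ p ∣ Nat.card J ∧ p ∣ Nat.card N},
      Quot (cohRelIn φ (Np p : Subgroup N)) := fun c p =>
    Quot.map (CrossedHom.primaryPart (Np p))
      (fun _ _ => CrossedHom.cohRelIn_primaryPart (Np p)) c
  have hinj : Function.Injective e := by
    rintro ⟨f⟩ ⟨g⟩ hfg
    refine Quot.sound (CrossedHom.cohRel_of_primaryPart fun p hp hpN => ?_)
    by_cases hpJ : p ∣ Nat.card J
    · exact ⟨Np ⟨p, hp.out, hpJ, hpN⟩, (cohRelIn_equivalence φ _).quot_mk_eq_iff _ _ |>.1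
        (congrFun hfg ⟨p, hp.out, hpJ, hpN⟩)⟩
    · exact ⟨default, CrossedHom.cohRelIn_primaryPart_of_not_dvd hpJ _ f g⟩
  have he (f : CrossedHom φ) (g : ∀ p : {p : ℕ // p.Prime ∧ p ∣ Nat.card J ∧ p ∣ Nat.card N},
      CrossedHomIn φ (Np p : Subgroup N))
      (h : ∀ p j, primaryPart N p.1 (f.1 j) = (g p).1 j) :
      e (Quot.mk _ f) = fun p => Quot.mk _ (g p) :=
    funext fun p => congrArg (Quot.mk _) (Subtype.ext (funext (h p)))
  have hsurj : Function.Surjective e := by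
    intro c
    choose g hg using fun p => Quot.exists_rep (c p)
    obtain ⟨f, hf⟩ := CrossedHom.exists_primaryPart_eq (φ := φ)
      (fun p j => if hp : p.Prime ∧ p ∣ Nat.card J ∧ p ∣ Nat.card N then (g ⟨p, hp⟩).1 j else 1)
      fun p _ _ => by
        by_cases hp : p.Prime ∧ p ∣ Nat.card J ∧ p ∣ Nat.card N
        · simp only [dif_pos hp]
          exact ⟨(g ⟨p, hp⟩).2.1, fun j => primaryPart_of_mem (Np ⟨p, hp⟩) ((g ⟨p, hp⟩).2.2 j)⟩
        · simp [dif_neg hp]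
    refine ⟨Quot.mk _ f, (he f g fun p j => ?_).trans (funext hg)⟩
    rw [hf p.1 p.2.2.2, dif_pos p.2]
  refine ⟨Equiv.ofBijective e ⟨hinj, hsurj⟩, fun f g h => he f g fun p j => ?_⟩
  have hg : primaryPart N p.1 ((g p).1 j) = (g p).1 j := primaryPart_of_mem (Np p) ((g p).2.2 j)
  have := primaryPart_of_coprime (h p j)
  rwa [map_mul, map_inv, hg, mul_inv_eq_one] at this
end

section
/- (Losey–Stonehewer) Let G be a finite group with a normal nilpotent subgroup N, and let J, J' be two nilpotent complements of N in G. If J and J' are locally conjugate in G (i.e., for every prime p, some Sylow p-subgroup of J is conjugate in G to some Sylow p-subgroup of J'), then J and J' are conjugate in G. -/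
open scoped Pointwise

namespace Subgroup

variable {G : Type*} [Group G]

theorem isComplement'_of_isPGroup_of_sup_eq_top {p q : ℕ} [Fact p.Prime] [Fact q.Prime]
    (hpq : p ≠ q) {R T : Subgroup G} [R.Normal] (hR : IsPGroup p R) (hT : IsPGroup q T)
    (h : R ⊔ T = ⊤) : IsComplement' R T :=
  isComplement'_of_disjoint_and_mul_eq_univ (IsPGroup.disjoint_of_ne p q hpq R T hR hT) <| by
    rw [← normal_mul, h, coe_top]

theorem exists_conj_smul_eq_of_sup_eq_top [Finite G] {p q : ℕ} [Fact p.Prime] [Fact q.Prime]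
    (hpq : p ≠ q) {R T T' : Subgroup G} [R.Normal] (hR : IsPGroup p R) (hT : IsPGroup q T)
    (hT' : IsPGroup q T') (h : R ⊔ T = ⊤) (h' : R ⊔ T' = ⊤) :
    ∃ r ∈ R, MulAut.conj r • T = T' := by
  have key {U : Subgroup G} (hU : IsPGroup q U) (hRU : R ⊔ U = ⊤) : ¬ q ∣ U.index := by
    rw [(isComplement'_of_isPGroup_of_sup_eq_top hpq hR hU hRU).index_eq_card]
    obtain ⟨n, hn⟩ := IsPGroup.iff_card.mp hR
    rw [hn]
    intro hd
    exact hpq ((Nat.prime_dvd_prime_iff_eq Fact.out Fact.out).mp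
      ((Fact.out : q.Prime).dvd_of_dvd_pow hd)).symm
  obtain ⟨g, hg⟩ := MulAction.exists_smul_eq G (hT.toSylow (key hT h)) (hT'.toSylow (key hT' h'))
  have hg' : MulAut.conj g • T = T' := congrArg (fun P : Sylow q G => (P : Subgroup G)) hg
  obtain ⟨r, hr, t, ht, rfl⟩ := mem_sup_of_normal_left.mp (h ▸ mem_top g : g ∈ R ⊔ T)
  refine ⟨r, hr, ?_⟩
  rwa [map_mul, mul_smul, conj_smul_eq_self_of_mem ht] at hg'

theorem exists_conj_smul_eq_of_le_centralizer [Finite G] {p q : ℕ} [Fact p.Prime] [Fact q.Prime]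
    (hpq : p ≠ q) {R T T' X : Subgroup G} [R.Normal] (hR : IsPGroup p R) (hT : IsPGroup q T)
    (hT' : IsPGroup q T') (hTX : T ≤ centralizer X) (hTX' : T' ≤ centralizer X)
    (h : R ⊔ T = R ⊔ T') :
    ∃ r ∈ R ⊓ centralizer X, MulAut.conj r • T = T' := by
  set D := centralizer (X : Set G) ⊓ (R ⊔ T) with hD
  have key {U : Subgroup G} (hU : U ≤ D) (hRU : R ⊔ T = R ⊔ U) :
      R.subgroupOf D ⊔ U.subgroupOf D = ⊤ := by
    rw [eq_top_iff]
    rintro ⟨x, hx⟩ -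
    obtain ⟨r, hr, u, hu, rfl⟩ := mem_sup_of_normal_left.mp (hRU ▸ hx.2)
    have hrD : r ∈ D := by simpa using D.mul_mem hx (D.inv_mem (hU hu))
    exact mul_mem_sup (mem_subgroupOf (h := ⟨r, hrD⟩).mpr hr)
      (mem_subgroupOf (h := ⟨u, hU hu⟩).mpr hu)
  have hTD : T ≤ D := le_inf hTX le_sup_right
  have hTD' : T' ≤ D := le_inf hTX' (h ▸ le_sup_right)
  obtain ⟨r, hr, hrT⟩ := exists_conj_smul_eq_of_sup_eq_top hpq
    (R := R.subgroupOf D) (T := T.subgroupOf D) (T' := T'.subgroupOf D)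
    (hR.comap_subtype) (hT.comap_subtype) (hT'.comap_subtype) (key hTD rfl) (key hTD' h)
  refine ⟨r, ⟨hr, r.2.1⟩, ?_⟩
  rw [conj_smul_subgroupOf hTD] at hrT
  rw [← inf_of_le_left hTD', ← subgroupOf_map_subtype, ← hrT, subgroupOf_map_subtype,
    inf_of_le_left (conj_smul_le_of_le hTD r)]

theorem sup_conj_smul_of_mem {R : Subgroup G} [R.Normal] (T : Subgroup G) {r : G} (hr : r ∈ R) :
    R ⊔ MulAut.conj r • T = R ⊔ T := by
  rw [← Normal.conj_smul_eq_self r R, ← smul_sup, Normal.conj_smul_eq_self r R,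
    conj_smul_eq_self_of_mem (mem_sup_left hr)]

theorem conj_smul_eq_self_of_mem_centralizer {X : Subgroup G} {g : G}
    (hg : g ∈ centralizer (X : Set G)) : MulAut.conj g • X = X := by
  have key {g x : G} (hg : g ∈ centralizer (X : Set G)) (hx : x ∈ X) : MulAut.conj g • x = x := by
    rw [MulAut.smul_def, MulAut.conj_apply, ← hg x hx, mul_inv_cancel_right]
  ext x
  rw [mem_smul_pointwise_iff_exists]
  exact ⟨fun ⟨y, hy, hyx⟩ => hyx ▸ (key hg hy).symm ▸ hy, fun hx => ⟨x, hx, key hg hx⟩⟩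

theorem map_le_centralizer_map {H : Type*} [Group H] (f : G →* H) {U V : Subgroup G}
    (h : U ≤ centralizer V) : U.map f ≤ centralizer (V.map f : Subgroup H) := by
  rintro _ ⟨u, hu, rfl⟩ _ ⟨v, hv, rfl⟩
  rw [← map_mul, ← map_mul, h hu v hv]

/-- Two commuting families of `q i`-subgroups that agree modulo a normal `p`-subgroup `R`, with
all `q i ≠ p`, are simultaneously conjugate by an element of `R` centralizing `X`. -/
theorem exists_conj_smul_eq_family [Finite G] {p : ℕ} [Fact p.Prime] {R : Subgroup G} [R.Normal]
    (hR : IsPGroup p R) {ι : Type*} {q : ι → ℕ} (hq : ∀ i, (q i).Prime) {B : ι → Subgroup G}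
    (hB : ∀ i, IsPGroup (q i) (B i))
    (hBB : Pairwise fun i j => B i ≤ centralizer (B j)) (s : Finset ι) :
    ∀ (X : Subgroup G) (A : ι → Subgroup G), (∀ i ∈ s, p ≠ q i) → (∀ i, IsPGroup (q i) (A i)) →
      (Pairwise fun i j => A i ≤ centralizer (A j)) → (∀ i ∈ s, A i ≤ centralizer X) →
      (∀ i ∈ s, B i ≤ centralizer X) → (∀ i, R ⊔ A i = R ⊔ B i) →
      ∃ r ∈ R ⊓ centralizer X, ∀ i ∈ s, MulAut.conj r • A i = B i := by
  classical
  induction s using Finset.induction_on with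
  | empty => exact fun X A _ _ _ _ _ _ => ⟨1, one_mem _, by simp⟩
  | insert i s hi ih =>
    intro X A hpq hA hAA hAX hBX hAB
    have := Fact.mk (hq i)
    obtain ⟨r, hr, hri⟩ := exists_conj_smul_eq_of_le_centralizer (hpq i (by simp)) hR (hA i)
      (hB i) (hAX i (by simp)) (hBX i (by simp)) (hAB i)
    have hrX : MulAut.conj r • X = X := conj_smul_eq_self_of_mem_centralizer hr.2
    have hmono {U V : Subgroup G} (h : U ≤ centralizer V) :
        MulAut.conj r • U ≤ centralizer (MulAut.conj r • V : Subgroup G) :=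
      map_le_centralizer_map _ h
    have hne {j : ι} (hj : j ∈ s) : j ≠ i := fun h => hi (h ▸ hj)
    have hsup {U : Subgroup G} (h : U ≤ centralizer X) (h' : U ≤ centralizer (B i)) :
        U ≤ centralizer (X ⊔ B i : Subgroup G) := by
      rw [le_centralizer_iff] at h h' ⊢
      exact sup_le h h'
    obtain ⟨t, ht, hts⟩ := ih (X ⊔ B i) (fun j => MulAut.conj r • A j)
      (fun j hj => hpq j (by simp [hj])) (fun j => (hA j).map _)
      (fun j k hjk => hmono (hAA hjk))
      (fun j hj => hsup (hrX ▸ hmono (hAX j (by simp [hj]))) (hri ▸ hmono (hAA (hne hj))))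
      (fun j hj => hsup (hBX j (by simp [hj])) (hBB (hne hj)))
      (fun j => (sup_conj_smul_of_mem _ hr.1).trans (hAB j))
    refine ⟨t * r, mul_mem ⟨ht.1, centralizer_le (by exact_mod_cast le_sup_left) ht.2⟩ hr, ?_⟩
    intro j hj
    rw [map_mul, mul_smul]
    rcases Finset.mem_insert.mp hj with rfl | hj
    · rw [hri]
      exact conj_smul_eq_self_of_mem_centralizer
        (centralizer_le (by exact_mod_cast le_sup_right) ht.2)
    · exact hts j hj

theorem map_conj_smul {H : Type*} [Group H] (f : G →* H) (g : G) (K : Subgroup G) :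
    (MulAut.conj g • K).map f = MulAut.conj (f g) • K.map f := by
  change (K.map (MulAut.conj g).toMonoidHom).map f =
    (K.map f).map (MulAut.conj (f g)).toMonoidHom
  rw [map_map, map_map]
  congr 1
  ext x
  simp

theorem conj_smul_iSup {ι : Sort*} (g : G) (A : ι → Subgroup G) :
    MulAut.conj g • ⨆ i, A i = ⨆ i, MulAut.conj g • A i :=
  map_iSup _ _

theorem not_dvd_orderOf_of_mem_biSup {ι : Type*} {q : ι → ℕ} (hq : ∀ i, (q i).Prime)
    {A : ι → Subgroup G} [∀ i, (A i).Normal] (hA : ∀ i, IsPGroup (q i) (A i))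
    (hAA : Pairwise fun i j => A i ≤ centralizer (A j)) {p : ℕ} (hp : p.Prime) (s : Finset ι)
    (hs : ∀ i ∈ s, p ≠ q i) : ∀ x ∈ ⨆ i ∈ s, A i, ¬ p ∣ orderOf x := by
  classical
  induction s using Finset.induction_on with
  | empty =>
    intro x hx
    have : x = 1 := by simpa using hx
    simpa [this] using hp.one_lt.ne'
  | insert i s hi ih =>
    intro x hx
    rw [Finset.iSup_insert] at hx
    obtain ⟨a, ha, y, hy, rfl⟩ := mem_sup_of_normal_left.mp hx
    have hay : Commute a y := by
      have hle : ⨆ j ∈ s, A j ≤ centralizer (A i) :=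
        iSup₂_le fun j hj => hAA fun h => hi (h ▸ hj)
      exact hle hy a ha
    intro hd
    rcases (Nat.Prime.dvd_lcm hp).mp (hd.trans hay.orderOf_mul_dvd_lcm) with h | h
    · obtain ⟨n, hn⟩ := hA i ⟨a, ha⟩
      have hn' : a ^ q i ^ n = 1 := congrArg Subtype.val hn
      exact hs i (by simp) ((Nat.prime_dvd_prime_iff_eq hp (hq i)).mp
        (hp.dvd_of_dvd_pow (h.trans (orderOf_dvd_of_pow_eq_one hn'))))
    · exact ih (fun j hj => hs j (by simp [hj])) y hy h

/-- The Sylow subgroups of a nilpotent subgroup `K`, as subgroups of `G`. -/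
theorem exists_sylow_family [Finite G] (K : Subgroup G) [Group.IsNilpotent K] :
    ∃ A : (Nat.card G).primeFactors → Subgroup G,
      (∀ (p : (Nat.card G).primeFactors) (P : Sylow p K), (P : Subgroup K).map K.subtype = A p) ∧
      (∀ p : (Nat.card G).primeFactors, IsPGroup p (A p)) ∧
      (Pairwise fun p q => A p ≤ centralizer (A q)) ∧
      ⨆ p, A p = K ∧ (∀ p, ∀ k ∈ K, MulAut.conj k • A p = A p) ∧
      (K.Normal → ∀ p, (A p).Normal) := by
  have hprime (p : (Nat.card G).primeFactors) : Fact (p : ℕ).Prime :=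
    ⟨Nat.prime_of_mem_primeFactors p.2⟩
  let S (p : (Nat.card G).primeFactors) : Sylow p K := default
  have hS (p) : (S p : Subgroup K).Normal := inferInstance
  refine ⟨fun p => (S p : Subgroup K).map K.subtype, fun p P => ?_, fun p => (S p).2.map _,
    fun p q hpq => ?_, ?_, fun p k hk => ?_, fun hK p => ?_⟩
  · have := (S p).unique_of_normal (hS p)
    rw [Subsingleton.elim P (S p)]
  · refine map_le_centralizer_map _ fun x hx y hy => ?_
    have hd : Disjoint (S q : Subgroup K) (S p) :=
      IsPGroup.disjoint_of_ne q p (fun h => hpq (Subtype.ext h.symm)) _ _ (S q).2 (S p).2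
    exact commute_of_normal_of_disjoint _ _ (hS q) (hS p) hd y x hy hx
  · rw [← map_iSup]
    suffices h : ⨆ p, (S p : Subgroup K) = ⊤ by rw [h, ← MonoidHom.range_eq_map, range_subtype]
    rw [← index_eq_one]
    by_contra hne
    obtain ⟨r, hr, hrd⟩ := Nat.exists_prime_and_dvd hne
    have hrG : r ∈ (Nat.card G).primeFactors := Nat.mem_primeFactors.mpr
      ⟨hr, (hrd.trans (index_dvd_card _)).trans (card_subgroup_dvd_card K), Nat.card_pos.ne'⟩
    exact (S ⟨r, hrG⟩).not_dvd_index
      (hrd.trans (index_dvd_of_le (le_iSup (fun p => (S p : Subgroup K)) ⟨r, hrG⟩)))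
  · exact (map_conj_smul K.subtype ⟨k, hk⟩ (S p : Subgroup K)).symm.trans
      (congrArg _ (Normal.conj_smul_eq_self _ _))
  · have := Sylow.characteristic_of_normal (S p) (hS p)
    infer_instance

theorem exists_conj_smul_sup_eq [Finite G] {p : ℕ} [Fact p.Prime] {P M : Subgroup G} [P.Normal]
    [M.Normal] (hP : IsPGroup p P) {ι : Type*} [Fintype ι] {q : ι → ℕ} (hq : ∀ i, (q i).Prime)
    (i₀ : ι) (hpq : ∀ i, i ≠ i₀ → p ≠ q i) {A B : ι → Subgroup G}
    (hA : ∀ i, IsPGroup (q i) (A i)) (hB : ∀ i, IsPGroup (q i) (B i))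
    (hAA : Pairwise fun i j => A i ≤ centralizer (A j))
    (hBB : Pairwise fun i j => B i ≤ centralizer (B j))
    (h : ∀ i, ∃ n ∈ P ⊔ M, MulAut.conj n • A i = B i) :
    ∃ a ∈ P, MulAut.conj a • ((⨆ i, A i) ⊔ M) = (⨆ i, B i) ⊔ M := by
  classical
  set π := QuotientGroup.mk' M with hπ
  have hR : (P.map π).Normal := ‹P.Normal›.map π (QuotientGroup.mk'_surjective M)
  have hmem {n : G} (hn : n ∈ P ⊔ M) : π n ∈ P.map π := by
    obtain ⟨a, ha, m, hm, rfl⟩ := mem_sup_of_normal_left.mp hn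
    exact ⟨a, ha, by simpa [hπ] using hm⟩
  choose n hn hnAB using h
  have hnAB' (i : ι) : MulAut.conj (π (n i)) • (A i).map π = (B i).map π := by
    rw [← map_conj_smul, hnAB]
  obtain ⟨c, ⟨⟨a, ha, rfl⟩, hcB⟩, hc⟩ := exists_conj_smul_eq_family (hP.map π) hq
    (B := fun i => (B i).map π) (fun i => (hB i).map π)
    (fun i j hij => map_le_centralizer_map π (hBB hij)) (Finset.univ.erase i₀)
    ((B i₀).map π) (fun i => MulAut.conj (π (n i₀)) • (A i).map π)
    (fun i hi => hpq i (Finset.ne_of_mem_erase hi)) (fun i => ((hA i).map π).map _)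
    (fun i j hij => map_le_centralizer_map _ (map_le_centralizer_map π (hAA hij)))
    (fun i hi => hnAB' i₀ ▸ map_le_centralizer_map _
      (map_le_centralizer_map π (hAA (Finset.ne_of_mem_erase hi))))
    (fun i hi => map_le_centralizer_map π (hBB (Finset.ne_of_mem_erase hi)))
    (fun i => by
      rw [sup_conj_smul_of_mem _ (hmem (hn i₀)), ← hnAB' i, sup_conj_smul_of_mem _ (hmem (hn i))])
  have hall (i : ι) : MulAut.conj (π a) • MulAut.conj (π (n i₀)) • (A i).map π = (B i).map π := by
    by_cases hi : i = i₀
    · rw [hi, hnAB', conj_smul_eq_self_of_mem_centralizer hcB]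
    · exact hc i (by simp [hi])
  obtain ⟨a', ha', m, hm, hn₀⟩ := mem_sup_of_normal_left.mp (hn i₀)
  refine ⟨a * a', mul_mem ha ha', ?_⟩
  have hmap : (MulAut.conj (a * n i₀) • ⨆ i, A i).map π = (⨆ i, B i).map π := by
    rw [conj_smul_iSup, map_iSup, map_iSup]
    refine iSup_congr fun i => ?_
    rw [← hall, map_conj_smul, map_mul, map_mul, mul_smul]
  rw [map_eq_map_iff, hπ, QuotientGroup.ker_mk'] at hmap
  rw [← hmap, ← hn₀, ← mul_assoc, map_mul _ (a * a') m, mul_smul]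
  conv_rhs => rw [← Normal.conj_smul_eq_self (a * a') M, ← smul_sup,
    ← Normal.conj_smul_eq_self m M, ← smul_sup, conj_smul_eq_self_of_mem (mem_sup_right hm)]

end Subgroup

open Subgroup in
/-- (Losey–Stonehewer.) Two nilpotent complements `J`, `J'` of a normal nilpotent
subgroup `N` in a finite group `G` are conjugate if they are locally conjugate
(for every prime `p`, some Sylow `p`-subgroup of `J` is conjugate in `G` to some
Sylow `p`-subgroup of `J'`). -/
theorem stmt_11 {G : Type*} [Group G] [Finite G] (N J J' : Subgroup G)
    [N.Normal] [Group.IsNilpotent N]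
    [Group.IsNilpotent J] [Group.IsNilpotent J']
    (hJ : Subgroup.IsComplement' N J) (hJ' : Subgroup.IsComplement' N J')
    (hloc : ∀ p : ℕ, p.Prime →
      ∃ (P : Sylow p J) (P' : Sylow p J') (g : G),
        ((P : Subgroup J).map J.subtype).map (MulAut.conj g).toMonoidHom =
          (P' : Subgroup J').map J'.subtype) :
    ∃ g : G, J.map (MulAut.conj g).toMonoidHom = J' := by
  obtain ⟨C, -, hC, hCC, hCN, -, hCnormal⟩ := exists_sylow_family N
  obtain ⟨A, hPA, hA, hAA, hAJ, hJA, -⟩ := exists_sylow_family J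
  obtain ⟨B, hPB, hB, hBB, hBJ, -, -⟩ := exists_sylow_family J'
  have := hCnormal inferInstance
  have hprime (p : (Nat.card G).primeFactors) : (p : ℕ).Prime :=
    Nat.prime_of_mem_primeFactors p.2
  have hAB (p) : ∃ n ∈ N, MulAut.conj n • A p = B p := by
    obtain ⟨P, P', g, hg⟩ := hloc p (hprime p)
    rw [hPA, hPB] at hg
    obtain ⟨n, hn, j, hj, rfl⟩ := mem_sup_of_normal_left.mp (hJ.sup_eq_top ▸ mem_top g)
    refine ⟨n, hn, ?_⟩
    rw [← hJA p j hj, ← mul_smul, ← map_mul]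
    exact hg
  let M (p : (Nat.card G).primeFactors) : Subgroup G := ⨆ q ∈ Finset.univ.erase p, C q
  have hCM (p) : C p ⊔ M p = N := by
    rw [← Finset.iSup_insert, Finset.insert_erase (Finset.mem_univ p)]
    simpa using hCN
  have hCM' {p q} (hpq : p ≠ q) : C p ≤ M q :=
    le_iSup₂_of_le p (Finset.mem_erase.mpr ⟨hpq, Finset.mem_univ p⟩) le_rfl
  have hstep (p) : ∃ c ∈ C p, MulAut.conj c • (J ⊔ M p) = J' ⊔ M p := by
    have := Fact.mk (hprime p)
    have h := exists_conj_smul_sup_eq (M := M p) (hC p) hprime p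
      (fun i hi h => hi (Subtype.ext h.symm)) hA hB hAA hBB (by rwa [hCM])
    rwa [hAJ, hBJ] at h
  have hglue (s : Finset (Nat.card G).primeFactors) :
      ∃ g ∈ ⨆ p ∈ s, C p, ∀ p ∈ s, MulAut.conj g • (J ⊔ M p) = J' ⊔ M p := by
    induction s using Finset.induction_on with
    | empty => exact ⟨1, one_mem _, by simp⟩
    | insert p s hp ih =>
      obtain ⟨g, hg, hgs⟩ := ih
      obtain ⟨c, hc, hcp⟩ := hstep p
      refine ⟨g * c, ?_, fun q hq => ?_⟩
      · rw [Finset.iSup_insert]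
        exact mul_mem (mem_sup_right hg) (mem_sup_left hc)
      rw [map_mul, mul_smul]
      rcases Finset.mem_insert.mp hq with rfl | hq
      · rw [hcp]
        have hle : ⨆ r ∈ s, C r ≤ M q := iSup₂_le fun r hr => hCM' fun h => hp (h ▸ hr)
        exact conj_smul_eq_self_of_mem (mem_sup_right (hle hg))
      · rw [conj_smul_eq_self_of_mem (mem_sup_right (hCM' (ne_of_mem_of_not_mem hq hp).symm hc)),
          hgs q hq]
  obtain ⟨g, -, hg⟩ := hglue Finset.univ
  have hle : MulAut.conj g • J ≤ J' := by
    intro x hx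
    obtain ⟨n, hn, j, hj, rfl⟩ := mem_sup_of_normal_left.mp (hJ'.sup_eq_top ▸ mem_top x)
    have hnM (p) : n ∈ M p := by
      have hxp : n * j ∈ J' ⊔ M p := by
        rw [← hg p (Finset.mem_univ p), smul_sup]
        exact mem_sup_left hx
      obtain ⟨m, hm, k, hk, hmk⟩ := mem_sup_of_normal_left.mp (sup_comm J' (M p) ▸ hxp)
      have hmN : m ∈ N := hCM p ▸ mem_sup_right hm
      have h := hJ'.1 (a₁ := (⟨m, hmN⟩, ⟨k, hk⟩)) (a₂ := (⟨n, hn⟩, ⟨j, hj⟩)) hmk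
      simp only [Prod.mk.injEq, Subtype.mk.injEq] at h
      exact h.1 ▸ hm
    have hn1 : n = 1 := by
      rw [← orderOf_eq_one_iff]
      by_contra hne
      obtain ⟨r, hr, hrd⟩ := Nat.exists_prime_and_dvd hne
      have hrG : r ∈ (Nat.card G).primeFactors :=
        Nat.mem_primeFactors.mpr ⟨hr, hrd.trans (orderOf_dvd_natCard n), Nat.card_pos.ne'⟩
      refine not_dvd_orderOf_of_mem_biSup hprime hC hCC hr _ (fun i hi h => ?_) n
        (hnM ⟨r, hrG⟩) hrd
      exact Finset.ne_of_mem_erase hi (Subtype.ext h.symm)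
    simpa [hn1] using hj
  refine ⟨g, eq_of_le_of_card_ge hle ?_⟩
  have hcard : Nat.card (J.map (MulAut.conj g).toMonoidHom) = Nat.card J :=
    card_map_of_injective (MulAut.conj g).injective
  rw [hcard]
  exact le_of_eq (Nat.eq_of_mul_eq_mul_left Nat.card_pos (hJ'.card_mul_card.trans hJ.card_mul_card.symm))
end

section
/- (Proposition 3) Let G be a finite group that splits over a normal nilpotent subgroup N with G/N nilpotent. Suppose that for each prime p there exists a Sylow p-subgroup S of G such that any two complements of S ∩ N in S are conjugate in G. Then any two complements of N in G are conjugate in G. -/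
/-- A `q`-group acting through `g ↦ φ₂ x * g * (φ₁ x)⁻¹` on an invariant set of cardinality prime
to `q` has a fixed point. -/
theorem exists_intertwiner_of_isPGroup {G Q : Type*} [Group G] [Finite G] [Group Q] [Finite Q]
    {q : ℕ} [Fact q.Prime] (hQ : IsPGroup q Q) (φ₁ φ₂ : Q →* G) (X : Set G)
    (hX : ∀ x, ∀ g ∈ X, φ₂ x * g * (φ₁ x)⁻¹ ∈ X) (hcard : ¬ q ∣ Nat.card X) :
    ∃ g ∈ X, ∀ x, φ₂ x * g = g * φ₁ x := by
  let act : MulAction Q X :=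
    { smul := fun x g ↦ ⟨φ₂ x * g * (φ₁ x)⁻¹, hX x g g.2⟩
      one_smul := fun g ↦ Subtype.ext (by
        change φ₂ 1 * (g : G) * (φ₁ 1)⁻¹ = g
        simp)
      mul_smul := fun x y g ↦ Subtype.ext (by
        change φ₂ (x * y) * (g : G) * (φ₁ (x * y))⁻¹ = φ₂ x * (φ₂ y * g * (φ₁ y)⁻¹) * (φ₁ x)⁻¹
        simp [mul_assoc]) }
  obtain ⟨g, hg⟩ := hQ.nonempty_fixed_point_of_prime_not_dvd_card X hcard
  refine ⟨g, g.2, fun x ↦ ?_⟩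
  have h : φ₂ x * (g : G) * (φ₁ x)⁻¹ = g := congrArg Subtype.val (hg x)
  exact mul_inv_eq_iff_eq_mul.mp h

/-- Two homomorphisms from a nilpotent group which agree modulo a normal `p`-subgroup `N` and are
`N`-conjugate on a Sylow `p`-subgroup are `N`-conjugate. -/
theorem exists_intertwiner_of_normal_isPGroup {G Q : Type*} [Group G] [Finite G] [Group Q]
    [Finite Q] [Group.IsNilpotent Q] {p : ℕ} [Fact p.Prime] (N : Subgroup G) [N.Normal]
    (hN : IsPGroup p N) (φ₁ φ₂ : Q →* G) (hφ : ∀ x, φ₂ x * (φ₁ x)⁻¹ ∈ N) (P : Sylow p Q)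
    (hP : ∃ n ∈ N, ∀ x ∈ P, φ₂ x * n = n * φ₁ x) :
    ∃ n ∈ N, ∀ x, φ₂ x * n = n * φ₁ x := by
  let s : Set (Subgroup Q) :=
    {R | R.Normal ∧ P ≤ R ∧ ∃ n ∈ N, ∀ x ∈ R, φ₂ x * n = n * φ₁ x}
  have hPs : (P : Subgroup Q) ∈ s := ⟨inferInstance, le_rfl, hP⟩
  obtain ⟨R, -, hR⟩ := (Set.toFinite s).exists_le_maximal hPs
  obtain ⟨hRn, hPR, n₀, hn₀, hRn₀⟩ := hR.prop
  by_cases htop : R = ⊤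
  · exact ⟨n₀, hn₀, fun x ↦ hRn₀ x (htop ▸ Subgroup.mem_top x)⟩
  exfalso
  obtain ⟨q, hq, hqR⟩ := Nat.exists_prime_and_dvd (mt Subgroup.index_eq_one.mp htop)
  have := Fact.mk hq
  have hqp : q ≠ p := by
    rintro rfl
    exact P.not_dvd_index (hqR.trans (Subgroup.index_dvd_of_le hPR))
  obtain ⟨T⟩ : Nonempty (Sylow q Q) := inferInstance
  let X : Set G := {g | g ∈ N ∧ ∀ r ∈ R, φ₂ r * g = g * φ₁ r}
  let D : Subgroup G := N ⊓ Subgroup.centralizer (φ₁ '' R)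
  have hXD : X = (fun g ↦ n₀ * g) '' D := by
    ext g
    constructor
    · rintro ⟨hgN, hg⟩
      refine ⟨n₀⁻¹ * g, ⟨N.mul_mem (N.inv_mem hn₀) hgN, ?_⟩, by simp⟩
      refine Subgroup.mem_centralizer_iff.mpr ?_
      rintro _ ⟨r, hr, rfl⟩
      rw [mul_assoc, ← hg r hr, ← mul_assoc, ← mul_assoc]
      congr 1
      rw [eq_inv_mul_iff_mul_eq, ← mul_assoc, ← hRn₀ r hr, mul_assoc, mul_inv_cancel, mul_one]
    · rintro ⟨d, ⟨hdN, hd⟩, rfl⟩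
      refine ⟨N.mul_mem hn₀ hdN, fun r hr ↦ ?_⟩
      have := Subgroup.mem_centralizer_iff.mp hd _ ⟨r, hr, rfl⟩
      rw [← mul_assoc, hRn₀ r hr, mul_assoc, this, mul_assoc]
  have hcard : ¬ q ∣ Nat.card X := by
    rw [hXD, Nat.card_image_of_injective (mul_right_injective n₀)]
    obtain ⟨k, hk⟩ := IsPGroup.iff_card.mp (hN.to_le (inf_le_left : D ≤ N))
    change ¬ q ∣ Nat.card D
    rw [hk]
    exact fun h ↦ hqp ((Nat.prime_dvd_prime_iff_eq hq Fact.out).mp (hq.dvd_of_dvd_pow h))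
  have hX : ∀ x : T, ∀ g ∈ X, φ₂ x * g * (φ₁ x)⁻¹ ∈ X := by
    rintro ⟨x, -⟩ g ⟨hgN, hg⟩
    refine ⟨?_, fun r hr ↦ ?_⟩
    · have : φ₂ x * g * (φ₁ x)⁻¹ = (φ₂ x * (φ₁ x)⁻¹) * (φ₁ x * g * (φ₁ x)⁻¹) := by group
      rw [this]
      exact N.mul_mem (hφ x) (Subgroup.Normal.conj_mem inferInstance g hgN _)
    · have h := hg (x⁻¹ * r * x) (by simpa using hRn.conj_mem r hr x⁻¹)
      simp only [map_mul, map_inv] at h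
      have h' : φ₂ r * (φ₂ x * g * (φ₁ x)⁻¹) =
          φ₂ x * ((φ₂ x)⁻¹ * φ₂ r * φ₂ x * g) * (φ₁ x)⁻¹ := by group
      rw [h', h]
      group
  obtain ⟨g, ⟨hgN, hgR⟩, hg⟩ := exists_intertwiner_of_isPGroup T.2
    (φ₁.comp (T : Subgroup Q).subtype) (φ₂.comp (T : Subgroup Q).subtype) X hX hcard
  have hle : R ⊔ T ∈ s := by
    refine ⟨inferInstance, hPR.trans le_sup_left, g, hgN, fun x hx ↦ ?_⟩
    have : R ⊔ T ≤ φ₂.eqLocus ((MulAut.conj g).toMonoidHom.comp φ₁) := by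
      refine sup_le (fun r hr ↦ ?_) (fun r hr ↦ ?_)
      · exact eq_mul_inv_of_mul_eq (hgR r hr)
      · exact eq_mul_inv_of_mul_eq (hg ⟨r, hr⟩)
    exact eq_mul_inv_iff_mul_eq.mp (this hx)
  have hTR : (T : Subgroup Q) ≤ R := le_sup_right.trans (hR.le_of_ge hle le_sup_left)
  exact T.not_dvd_index (hqR.trans (Subgroup.index_dvd_of_le hTR))

/-- In a nilpotent group, elements of order prime to `p` centralize the Sylow `p`-subgroup. -/
theorem Sylow.commute_of_pow_eq_one {N : Type*} [Group N] [Finite N] [Group.IsNilpotent N]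
    {p : ℕ} [hp : Fact p.Prime] (P : Sylow p N) {t : ℕ} (ht : p.Coprime t) {b : N}
    (hb : b ^ t = 1) {c : N} (hc : c ∈ P) : Commute c b := by
  let C : Subgroup N := Subgroup.centralizer (P : Subgroup N)
  have hC : Nat.Coprime C.index t := by
    refine Nat.coprime_of_dvd fun q hq hqC hqt ↦ ?_
    have := Fact.mk hq
    have hpq : p ≠ q := by
      rintro rfl
      exact hq.one_lt.ne' (Nat.dvd_one.mp (ht ▸ Nat.dvd_gcd dvd_rfl hqt))
    obtain ⟨T⟩ : Nonempty (Sylow q N) := inferInstance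
    have hTC : (T : Subgroup N) ≤ C := fun x hx ↦ Subgroup.mem_centralizer_iff.mpr fun y hy ↦
      Subgroup.commute_of_normal_of_disjoint _ _ inferInstance inferInstance
        (IsPGroup.disjoint_of_ne p q hpq _ _ P.2 T.2) y x hy hx
    exact T.not_dvd_index (hqC.trans (Subgroup.index_dvd_of_le hTC))
  have h : b ∈ C := by
    have h1 : b ^ C.index ∈ C := Subgroup.pow_index_mem C b
    have h2 : orderOf b ∣ t := orderOf_dvd_of_pow_eq_one hb
    obtain ⟨m, hm⟩ := exists_pow_eq_self_of_coprime (hC.coprime_dvd_right h2)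
    exact hm ▸ C.pow_mem h1 m
  exact Subgroup.mem_centralizer_iff.mp h c hc

/-- In a nilpotent group, every element is the product of an element of the Sylow `p`-subgroup and
an element whose order divides the index of that subgroup. -/
theorem Sylow.exists_mul_eq_of_isNilpotent {N : Type*} [Group N] [Finite N]
    [Group.IsNilpotent N] {p : ℕ} [Fact p.Prime] (P : Sylow p N) (m : N) :
    ∃ a ∈ P, ∃ b : N, b ^ (P : Subgroup N).index = 1 ∧ a * b = m := by
  set k := Nat.card P with hk
  set t := (P : Subgroup N).index with ht
  have hm : m ^ (k * t) = 1 := by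
    rw [hk, ht, Subgroup.card_mul_index, pow_card_eq_one']
  have hbez : ((k * k.gcdA t + t * k.gcdB t : ℤ)) = 1 := by
    rw [← Nat.gcd_eq_gcd_ab, P.card_coprime_index.gcd_eq_one, Nat.cast_one]
  refine ⟨m ^ (t * k.gcdB t : ℤ), ?_, m ^ (k * k.gcdA t : ℤ), ?_, ?_⟩
  · rw [zpow_mul, zpow_natCast]
    exact (P : Subgroup N).zpow_mem (Subgroup.pow_index_mem _ m) _
  · rw [← zpow_natCast, ← zpow_mul, mul_right_comm, zpow_mul, ← Nat.cast_mul, zpow_natCast, hm,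
      one_zpow]
  · rw [← zpow_add, add_comm, hbez, zpow_one]

/-- The decomposition of `Sylow.exists_mul_eq_of_isNilpotent` is unique. -/
theorem Sylow.eq_of_mul_eq_mul {N : Type*} [Group N] [Finite N] [Group.IsNilpotent N] {p : ℕ}
    [hp : Fact p.Prime] (P : Sylow p N) {a a' b b' : N} (ha : a ∈ P) (ha' : a' ∈ P)
    (hb : b ^ (P : Subgroup N).index = 1) (hb' : b' ^ (P : Subgroup N).index = 1)
    (h : a * b = a' * b') : a = a' := by
  have hc : a'⁻¹ * a ∈ (P : Subgroup N) := mul_mem (inv_mem ha') ha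
  have hcomm : Commute (a'⁻¹ * a) b :=
    P.commute_of_pow_eq_one ((Nat.Prime.coprime_iff_not_dvd hp.out).mpr P.not_dvd_index) hb hc
  have hpow : (a'⁻¹ * a) ^ (P : Subgroup N).index = 1 := by
    have h' : a'⁻¹ * a * b = b' := by rw [mul_assoc, h, inv_mul_cancel_left]
    rw [← h', hcomm.mul_pow, hb, mul_one] at hb'
    exact hb'
  have hord : orderOf (a'⁻¹ * a) = 1 :=
    Nat.eq_one_of_dvd_coprimes P.card_coprime_index
      (Subgroup.orderOf_dvd_natCard _ hc) (orderOf_dvd_of_pow_eq_one hpow)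
  exact (inv_mul_eq_one.mp (orderOf_eq_one_iff.mp hord)).symm

/-- Two homomorphisms from a nilpotent group which agree modulo a normal nilpotent subgroup `N` and
are `N`-conjugate on every Sylow subgroup are `N`-conjugate. -/
theorem exists_intertwiner_of_sylow {Q : Type*} [Group Q] [Finite Q] [Group.IsNilpotent Q]
    {G : Type*} [Group G] [Finite G] (N : Subgroup G) [N.Normal] [Group.IsNilpotent N]
    (φ₁ φ₂ : Q →* G) (hφ : ∀ x, φ₂ x * (φ₁ x)⁻¹ ∈ N)
    (hP : ∀ p : ℕ, p.Prime → ∀ P : Sylow p Q, ∃ n ∈ N, ∀ x ∈ P, φ₂ x * n = n * φ₁ x) :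
    ∃ n ∈ N, ∀ x, φ₂ x * n = n * φ₁ x := by
  induction hcard : Nat.card N using Nat.strong_induction_on generalizing G with
  | _ k ih =>
  by_cases hbot : N = ⊥
  · refine ⟨1, N.one_mem, fun x ↦ ?_⟩
    have := hφ x
    rw [hbot, Subgroup.mem_bot, mul_inv_eq_one] at this
    simp [this]
  obtain ⟨p, hp, hpN⟩ := Nat.exists_prime_and_dvd (mt Subgroup.card_eq_one.mp hbot)
  have := Fact.mk hp
  obtain ⟨S⟩ : Nonempty (Sylow p N) := inferInstance
  have hSchar : (S : Subgroup N).Characteristic := S.characteristic_of_normal inferInstance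
  let M : Subgroup G := (S : Subgroup N).map N.subtype
  have hMnormal : M.Normal := inferInstance
  have hM : IsPGroup p M := S.2.map _
  let π : G →* G ⧸ M := QuotientGroup.mk' M
  have hlt : Nat.card (N.map π) < k := by
    have hMN : M ≤ N := Subgroup.map_subtype_le _
    have hM1 : 1 < Nat.card M := by
      rw [Subgroup.one_lt_card_iff_ne_bot]
      intro h
      exact S.ne_bot_of_dvd_card hpN ((Subgroup.map_eq_bot_iff_of_injective _
        N.subtype_injective).mp h)
    have h := Subgroup.card_mul_index (M.subgroupOf N)
    have h2 : M.relIndex N = Nat.card (N.map π) := by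
      rw [← Subgroup.relIndex_ker, QuotientGroup.ker_mk']
    rw [Nat.card_congr (Subgroup.subgroupOfEquivOfLe hMN).toEquiv, ← Subgroup.relIndex, h2,
      hcard] at h
    rw [← h]
    exact lt_mul_of_one_lt_left Nat.card_pos hM1
  have hnil : Group.IsNilpotent (N.map π) :=
    Group.nilpotent_of_surjective _ (π.subgroupMap_surjective N)
  have hnormal : (N.map π).Normal :=
    Subgroup.Normal.map inferInstance _ (QuotientGroup.mk'_surjective M)
  obtain ⟨_, ⟨n, hn, rfl⟩, hnx⟩ := ih _ hlt (N.map π) (π.comp φ₁) (π.comp φ₂)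
    (fun x ↦ ⟨_, hφ x, by simp⟩)
    (fun r hr R ↦ by
      obtain ⟨m, hm, h⟩ := hP r hr R
      exact ⟨π m, ⟨m, hm, rfl⟩, fun x hx ↦ by
        simpa using congrArg π (h x hx)⟩) rfl
  let ψ : Q →* G := (MulAut.conj n).toMonoidHom.comp φ₁
  have hψ : ∀ x, ψ x = n * φ₁ x * n⁻¹ := fun x ↦ rfl
  have hψM : ∀ x, φ₂ x * (ψ x)⁻¹ ∈ M := by
    intro x
    have h : π (φ₂ x * (ψ x)⁻¹) = 1 := by
      have := hnx x
      simp only [MonoidHom.comp_apply] at this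
      rw [hψ, map_mul, map_inv, map_mul, map_mul, ← this, map_inv]
      group
    rwa [← MonoidHom.mem_ker, QuotientGroup.ker_mk'] at h
  obtain ⟨R⟩ : Nonempty (Sylow p Q) := inferInstance
  obtain ⟨m, hm, hmx⟩ := hP p hp R
  obtain ⟨a, ha, b, hb, hab⟩ :=
    S.exists_mul_eq_of_isNilpotent (⟨m, hm⟩ * ⟨n, hn⟩⁻¹ : N)
  have hab' : (a : G) * b = m * n⁻¹ := congrArg Subtype.val hab
  have hbR : ∀ x ∈ R, φ₂ x * a = a * ψ x := by
    intro x hx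
    have e1 : φ₂ x * (a * b : G) = (a * b : G) * ψ x := by
      rw [hab', hψ, ← mul_assoc, hmx x hx]
      group
    let b' : N := ⟨ψ x * b * (ψ x)⁻¹, Subgroup.Normal.conj_mem inferInstance _ b.2 _⟩
    have hb' : b' ^ (S : Subgroup N).index = 1 := by
      apply Subtype.ext
      simp only [b', SubmonoidClass.mk_pow, conj_pow]
      rw [← Subgroup.coe_pow, hb]
      simp
    have hM' : φ₂ x * a * (ψ x)⁻¹ ∈ M := by
      have : φ₂ x * a * (ψ x)⁻¹ = (φ₂ x * (ψ x)⁻¹) * (ψ x * a * (ψ x)⁻¹) := by group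
      rw [this]
      exact M.mul_mem (hψM x) (hMnormal.conj_mem _ ⟨a, ha, rfl⟩ _)
    obtain ⟨a', ha', haa⟩ := hM'
    have haa' : (a' : G) = φ₂ x * a * (ψ x)⁻¹ := haa
    have e2 : a' * b' = a * b := by
      apply Subtype.ext
      simp only [Subgroup.coe_mul, b', haa']
      rw [eq_comm, ← mul_inv_eq_iff_eq_mul.mpr e1]
      group
    have e3 : a' = a := S.eq_of_mul_eq_mul ha' ha hb' hb e2
    rw [e3] at haa'
    exact mul_inv_eq_iff_eq_mul.mp haa'.symm
  obtain ⟨c, hcM, hc⟩ := exists_intertwiner_of_normal_isPGroup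
    M hM ψ φ₂ hψM R ⟨a, ⟨a, ha, rfl⟩, hbR⟩
  refine ⟨c * n, N.mul_mem (Subgroup.map_subtype_le _ hcM) hn, fun x ↦ ?_⟩
  rw [← mul_assoc, hc x, hψ]
  group

/-- A complement of a normal subgroup `N` is the range of a section of `G → G ⧸ N`. -/
theorem Subgroup.IsComplement'.exists_section {G : Type*} [Group G] {N K : Subgroup G} [N.Normal]
    (h : N.IsComplement' K) :
    ∃ φ : G ⧸ N →* G, (∀ x, (φ x : G ⧸ N) = x) ∧ φ.range = K := by
  let e : G ⧸ N ≃* K := h.symm.QuotientMulEquiv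
  refine ⟨K.subtype.comp e.toMonoidHom, fun x ↦ ?_, ?_⟩
  · exact e.symm_apply_apply x
  · rw [MonoidHom.range_comp, MonoidHom.range_eq_top.mpr e.surjective, ← MonoidHom.range_eq_map,
      K.range_subtype]

/-- Let `φ` be a section of `G → G ⧸ N` and `R` a normal Sylow `p`-subgroup of `G ⧸ N`. Every Sylow
`p`-subgroup `S` of `G` contains a conjugate of `φ R`, and this is a complement of `S ⊓ N`. -/
theorem Sylow.exists_isComplement'_conj {G : Type*} [Group G] [Finite G] {N : Subgroup G}
    [N.Normal] {p : ℕ} [Fact p.Prime] (S : Sylow p G) (R : Sylow p (G ⧸ N)) [R.Normal]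
    (φ : G ⧸ N →* G) (hφ : ∀ x, (φ x : G ⧸ N) = x) :
    ∃ g : G, ∃ T : Subgroup (S : Subgroup G),
      (N.subgroupOf (S : Subgroup G)).IsComplement' T ∧
      T.map (S : Subgroup G).subtype =
        ((R : Subgroup (G ⧸ N)).map φ).map (MulAut.conj g).toMonoidHom := by
  obtain ⟨S', hS'⟩ := (R.2.map φ).exists_le_sylow
  obtain ⟨g, hg⟩ := MulAction.exists_smul_eq G S' S
  let T' : Subgroup G := ((R : Subgroup (G ⧸ N)).map φ).map (MulAut.conj g).toMonoidHom
  have hT' : T' ≤ S := by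
    rw [← hg]
    exact Subgroup.map_mono hS'
  refine ⟨g, T'.subgroupOf S, ?_, ?_⟩
  · apply Subgroup.isComplement'_of_disjoint_and_mul_eq_univ
    · rw [Subgroup.disjoint_def]
      rintro ⟨x, hxS⟩ hxN hxT
      obtain ⟨_, ⟨r, hr, rfl⟩, hrx⟩ := Subgroup.mem_subgroupOf.mp hxT
      have hxN' : x ∈ N := Subgroup.mem_subgroupOf.mp hxN
      have hrx' : g * φ r * g⁻¹ = x := hrx
      have h1 : φ r ∈ N := by
        have := Subgroup.Normal.conj_mem inferInstance x hxN' g⁻¹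
        rw [← hrx'] at this
        simpa [mul_assoc] using this
      have h2 : r = 1 := by rw [← hφ r, (QuotientGroup.eq_one_iff _).mpr h1]
      apply Subtype.ext
      simp [← hrx', h2]
    · refine Set.eq_univ_of_forall fun s ↦ ?_
      have hsR : ((s : G) : G ⧸ N) ∈ R := by
        have hp : IsPGroup p ((S : Subgroup G).map (QuotientGroup.mk' N)) := S.2.map _
        obtain ⟨R', hR'⟩ := hp.exists_le_sylow
        have := R.unique_of_normal inferInstance
        rw [Subsingleton.elim R R']
        exact hR' ⟨s, s.2, rfl⟩
      let r : G ⧸ N := (g : G ⧸ N)⁻¹ * ((s : G) : G ⧸ N) * g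
      have hr : r ∈ R := by
        have : r ∈ (R : Subgroup (G ⧸ N)) := by
          simpa [r] using Subgroup.Normal.conj_mem (H := (R : Subgroup (G ⧸ N))) inferInstance _
            hsR (g : G ⧸ N)⁻¹
        exact this
      have ht : g * φ r * g⁻¹ ∈ T' := ⟨φ r, ⟨r, hr, rfl⟩, rfl⟩
      let t : (S : Subgroup G) := ⟨g * φ r * g⁻¹, hT' ht⟩
      refine Set.mem_mul.mpr ⟨s * t⁻¹, ?_, t, ht, by simp⟩
      change (s : G) * (g * φ r * g⁻¹)⁻¹ ∈ N
      rw [← QuotientGroup.eq_one_iff]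
      simp [hφ, r, mul_assoc]
  · exact Subgroup.map_subgroupOf_eq_of_le hT'

/-- (Proposition 3.) Let `G` be a finite split extension over a nilpotent normal
subgroup `N` with `G/N` nilpotent. If for each prime `p` there is a Sylow
`p`-subgroup `S` of `G` such that any two complements of `S ∩ N` in `S` are
conjugate in `G`, then any two complements of `N` in `G` are conjugate. -/
theorem stmt_12 {G : Type*} [Group G] [Finite G] (N : Subgroup G)
    [N.Normal] [Group.IsNilpotent N] [Group.IsNilpotent (G ⧸ N)]
    (hsplit : ∃ K : Subgroup G, Subgroup.IsComplement' N K)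
    (hp : ∀ p : ℕ, p.Prime → ∃ S : Sylow p G,
      ∀ K₁ K₂ : Subgroup (S : Subgroup G),
        Subgroup.IsComplement' (N.subgroupOf (S : Subgroup G)) K₁ →
        Subgroup.IsComplement' (N.subgroupOf (S : Subgroup G)) K₂ →
        ∃ g : G, (K₁.map (S : Subgroup G).subtype).map (MulAut.conj g).toMonoidHom =
          K₂.map (S : Subgroup G).subtype) :
    ∀ K₁ K₂ : Subgroup G, Subgroup.IsComplement' N K₁ →
      Subgroup.IsComplement' N K₂ →
      ∃ g : G, K₁.map (MulAut.conj g).toMonoidHom = K₂ := by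
  intro K₁ K₂ hK₁ hK₂
  obtain ⟨φ₁, hφ₁, rfl⟩ := hK₁.exists_section
  obtain ⟨φ₂, hφ₂, rfl⟩ := hK₂.exists_section
  have hφ : ∀ x, φ₂ x * (φ₁ x)⁻¹ ∈ N := fun x ↦ by
    rw [← QuotientGroup.eq_one_iff]
    simp [hφ₁, hφ₂]
  obtain ⟨n, -, hn⟩ := exists_intertwiner_of_sylow N φ₁ φ₂ hφ fun p hp' R ↦ by
    have := Fact.mk hp'
    obtain ⟨S, hS⟩ := hp p hp'
    obtain ⟨g₁, T₁, hT₁, hT₁'⟩ := S.exists_isComplement'_conj R φ₁ hφ₁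
    obtain ⟨g₂, T₂, hT₂, hT₂'⟩ := S.exists_isComplement'_conj R φ₂ hφ₂
    obtain ⟨g, hg⟩ := hS T₁ T₂ hT₁ hT₂
    rw [hT₁', hT₂'] at hg
    let h : G := g₂⁻¹ * g * g₁
    let k : G ⧸ N := h
    refine ⟨h * (φ₁ k)⁻¹, ?_, fun x hx ↦ ?_⟩
    · rw [← QuotientGroup.eq_one_iff]
      simp [hφ₁, k]
    have hR : (R : Subgroup (G ⧸ N)).Normal := inferInstance
    have hxk : k⁻¹ * x * k ∈ (R : Subgroup (G ⧸ N)) := by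
      simpa using hR.conj_mem x hx k⁻¹
    have hmem : g * (g₁ * φ₁ (k⁻¹ * x * k) * g₁⁻¹) * g⁻¹ ∈
        ((R : Subgroup (G ⧸ N)).map φ₂).map (MulAut.conj g₂).toMonoidHom := by
      rw [← hg]
      exact ⟨_, ⟨_, ⟨_, hxk, rfl⟩, rfl⟩, rfl⟩
    obtain ⟨_, ⟨y, -, rfl⟩, hy⟩ := hmem
    have hy' : g₂ * φ₂ y * g₂⁻¹ = g * (g₁ * φ₁ (k⁻¹ * x * k) * g₁⁻¹) * g⁻¹ := hy
    have hy2 : φ₂ y = h * φ₁ (k⁻¹ * x * k) * h⁻¹ := by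
      have : φ₂ y = g₂⁻¹ * (g₂ * φ₂ y * g₂⁻¹) * g₂ := by group
      rw [this, hy']
      simp only [h]
      group
    have hyx : y = x := by
      rw [← hφ₂ y, hy2]
      change (k * (φ₁ (k⁻¹ * x * k) : G ⧸ N) * k⁻¹ : G ⧸ N) = x
      rw [hφ₁]
      group
    rw [← hyx, hy2, hyx]
    simp only [map_mul, map_inv]
    group
  refine ⟨n, ?_⟩
  have : φ₂ = (MulAut.conj n).toMonoidHom.comp φ₁ :=
    MonoidHom.ext fun x ↦ eq_mul_inv_of_mul_eq (hn x)
  rw [this, MonoidHom.range_comp]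
end
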